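/- For every integer k ≥ 2 there exists an integer N (depending on k) such that for every tree T on n ≥ N vertices, the sum of the k largest distance eigenvalues satisfies S_k(D(T)) ≥ 2n − 2k, and equality S_k(D(T)) = 2n − 2k holds if and only if T is the star K_{1,n−1}. -/

import Mathlib

open Finset SimpleGraph

/-- The distance matrix of a simple graph on `Fin n`, as a real matrix: the
`(i,j)` entry is the graph distance `d_G(i,j)`. -/
noncomputable def distMatrix {n : ℕ} (G : SimpleGraph (Fin n)) :
    Matrix (Fin n) (Fin n) ℝ :=
  fun i j => (G.dist i j : ℝ)

/-- The eigenvalues of the distance matrix, listed in decreasing order. -/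
noncomputable def distEigList {n : ℕ} (G : SimpleGraph (Fin n)) : List ℝ :=
  if h : (distMatrix G).IsHermitian then
    (List.ofFn h.eigenvalues).insertionSort (· ≥ ·)
  else []

/-- `distEig G k` is the `k`-th largest distance eigenvalue `λ_k(D(G))` (`1`-indexed). -/
noncomputable def distEig {n : ℕ} (G : SimpleGraph (Fin n)) (k : ℕ) : ℝ :=
  (distEigList G).getD (k - 1) 0

/-- `S_k(D(G))`, the sum of the `k` largest distance eigenvalues. -/
noncomputable def distEigSum {n : ℕ} (G : SimpleGraph (Fin n)) (k : ℕ) : ℝ :=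
  ((distEigList G).take k).sum

/-- `G` has independence number at most `s`: every set of pairwise
nonadjacent vertices has at most `s` elements. -/
def IndepNumLE {V : Type*} (G : SimpleGraph V) (s : ℕ) : Prop :=
  ∀ S : Finset V, (∀ u ∈ S, ∀ v ∈ S, u ≠ v → ¬ G.Adj u v) → S.card ≤ s


/-- quadratic form of a matrix -/
noncomputable def qf {n : ℕ} (M : Matrix (Fin n) (Fin n) ℝ) (x : Fin n → ℝ) : ℝ :=
  ∑ i, ∑ j, M i j * x i * x j

lemma distMatrix_herm {n : ℕ} (G : SimpleGraph (Fin n)) : (distMatrix G).IsHermitian := by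
  ext i j
  simp [distMatrix, Matrix.conjTranspose_apply, SimpleGraph.dist_comm]

lemma qf_eq {n : ℕ} (M : Matrix (Fin n) (Fin n) ℝ) (x : Fin n → ℝ) :
    qf M x = x ⬝ᵥ (M.mulVec x) := by
  simp only [qf, dotProduct, Matrix.mulVec, Finset.mul_sum]
  refine Finset.sum_congr rfl fun i _ => Finset.sum_congr rfl fun j _ => by ring

lemma spec {n : ℕ} (G : SimpleGraph (Fin n)) :
    ∃ (ν : ℕ → ℝ) (c : (Fin n → ℝ) →ₗ[ℝ] (Fin n → ℝ)),
      (∀ i j, i ≤ j → j < n → ν j ≤ ν i) ∧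
      (∀ x, qf (distMatrix G) x = ∑ i : Fin n, ν i * (c x i) ^ 2) ∧
      (∀ x, ∑ i, x i ^ 2 = ∑ i : Fin n, (c x i) ^ 2) ∧
      (∀ m ≤ n, distEigSum G m = ∑ i ∈ Finset.range m, ν i) ∧
      ∑ i ∈ Finset.range n, ν i = 0 := by
  have h := distMatrix_herm G
  let σ := Tuple.sort (fun i => - h.eigenvalues i)
  have hσ : Antitone (h.eigenvalues ∘ σ) := by
    intro i j hij
    have := Tuple.monotone_sort (fun i => - h.eigenvalues i) hij
    simp only [Function.comp] at this ⊢
    exact neg_le_neg_iff.mp this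
  let μ := h.eigenvalues ∘ σ
  have hlist : distEigList G = List.ofFn μ := by
    rw [distEigList, dif_pos h]
    have h1 : ((List.ofFn h.eigenvalues).insertionSort (· ≥ ·)).Perm (List.ofFn μ) :=
      (List.perm_insertionSort _ _).trans (Equiv.Perm.ofFn_comp_perm σ _).symm
    refine h1.eq_of_pairwise (fun a b _ _ hab hba => le_antisymm hba hab)
      (List.pairwise_insertionSort _ _) ?_
    exact hσ.sortedGE_ofFn.pairwise
  let ν : ℕ → ℝ := fun i => if hi : i < n then μ ⟨i, hi⟩ else 0
  have hν : ∀ i : Fin n, ν i = μ i := fun i => by simp [ν]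
  let U : Matrix (Fin n) (Fin n) ℝ := h.eigenvectorUnitary
  have hU : U * U.transpose = 1 := by
    have := Unitary.coe_mul_star_self h.eigenvectorUnitary
    simpa [Matrix.star_eq_conjTranspose, U] using this
  have hM : distMatrix G = U * Matrix.diagonal h.eigenvalues * U.transpose := by
    have := h.spectral_theorem
    rw [Unitary.conjStarAlgAut_apply] at this
    simpa [Matrix.star_eq_conjTranspose, U, Function.comp_def] using this
  let c : (Fin n → ℝ) →ₗ[ℝ] (Fin n → ℝ) :=
    (LinearMap.funLeft ℝ ℝ σ).comp (Matrix.mulVecLin U.transpose)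
  have hc : ∀ x i, c x i = (U.transpose.mulVec x) (σ i) := fun x i => rfl
  refine ⟨ν, c, ?_, ?_, ?_, ?_, ?_⟩
  · intro i j hij hj
    have hi : i < n := lt_of_le_of_lt hij hj
    simp only [ν, hi, hj, dif_pos]
    exact hσ hij
  · intro x
    rw [qf_eq]
    simp only [hν, hc, μ, Function.comp]
    rw [Equiv.sum_comp σ (fun i => h.eigenvalues i * (U.transpose.mulVec x i) ^ 2)]
    conv_lhs => rw [hM]
    rw [← Matrix.mulVec_mulVec, ← Matrix.mulVec_mulVec, Matrix.dotProduct_mulVec,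
      ← Matrix.mulVec_transpose]
    simp only [dotProduct, Matrix.mulVec_diagonal]
    exact Finset.sum_congr rfl fun i _ => by ring
  · intro x
    simp only [hc]
    rw [Equiv.sum_comp σ (fun i => (U.transpose.mulVec x i) ^ 2)]
    have : (U.transpose.mulVec x) ⬝ᵥ (U.transpose.mulVec x) = x ⬝ᵥ x := by
      rw [Matrix.dotProduct_mulVec, ← Matrix.mulVec_transpose, Matrix.transpose_transpose, Matrix.mulVec_mulVec, hU, Matrix.one_mulVec]
    simp only [dotProduct] at this
    simp only [pow_two]
    exact this.symm
  · intro m hm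
    rw [distEigSum, hlist, List.sum_take_ofFn]
    simp only [← hν]
    rw [Finset.sum_filter, Fin.sum_univ_eq_sum_range (fun i => if i < m then ν i else 0) n,
      ← Finset.sum_filter]
    refine Finset.sum_congr ?_ fun _ _ => rfl
    ext i; simp; omega
  · rw [← Fin.sum_univ_eq_sum_range]
    simp only [hν, μ, Function.comp]
    rw [Equiv.sum_comp σ h.eigenvalues]
    have := h.trace_eq_sum_eigenvalues
    simp only [RCLike.ofReal_real_eq_id, id] at this
    rw [← this]
    simp [Matrix.trace, distMatrix]

lemma lower {n : ℕ} {M : Matrix (Fin n) (Fin n) ℝ} {ν : ℕ → ℝ}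
    {c : (Fin n → ℝ) →ₗ[ℝ] (Fin n → ℝ)} (hν : ∀ i j, i ≤ j → j < n → ν j ≤ ν i)
    (hq : ∀ x, qf M x = ∑ i : Fin n, ν i * (c x i) ^ 2)
    (hn : ∀ x, ∑ i, x i ^ 2 = ∑ i : Fin n, (c x i) ^ 2)
    (s : Finset (Fin n)) (a : ℝ)
    (hs : ∀ x : Fin n → ℝ, (∀ i ∉ s, x i = 0) → a * ∑ i, x i ^ 2 ≤ qf M x)
    (p : ℕ) (hp : p < s.card) : a ≤ ν p := by
  by_contra hlt
  push Not at hlt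
  let f : (Fin n → ℝ) →ₗ[ℝ] ({i // i ∉ s} → ℝ) × (Fin p → ℝ) :=
    LinearMap.prod (LinearMap.funLeft ℝ ℝ Subtype.val)
      ((LinearMap.funLeft ℝ ℝ (fun i : Fin p => (⟨i, by
        have := Finset.card_le_univ s; simp at this; omega⟩ : Fin n))).comp c)
  have hpn : s.card ≤ n := by simpa using Finset.card_le_univ s
  have hk : LinearMap.ker f ≠ ⊥ := by
    apply LinearMap.ker_ne_bot_of_finrank_lt
    have : Fintype.card {i // i ∉ s} = n - s.card := by
      rw [Fintype.card_subtype_compl]; simp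
    simp [this]
    omega
  obtain ⟨x, hx, hx0⟩ := Submodule.exists_mem_ne_zero_of_ne_bot hk
  have hx' : f x = 0 := hx
  have h1 : ∀ i ∉ s, x i = 0 := fun i hi => congrFun (congrArg Prod.fst hx') ⟨i, hi⟩
  have h2 : ∀ i : Fin n, i.val < p → c x i = 0 := fun i hi =>
    congrFun (congrArg Prod.snd hx') ⟨i, hi⟩
  have h3 := hs x h1
  rw [hq] at h3
  have h4 : ∑ i : Fin n, ν i * (c x i) ^ 2 ≤ ν p * ∑ i, x i ^ 2 := by
    rw [hn, Finset.mul_sum]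
    refine Finset.sum_le_sum fun i _ => ?_
    by_cases hi : i.val < p
    · simp [h2 i hi]
    · exact mul_le_mul_of_nonneg_right (hν _ _ (by omega) i.2) (sq_nonneg _)
  have h5 : 0 < ∑ i, x i ^ 2 := by
    obtain ⟨i, hi⟩ := Function.ne_iff.mp hx0
    exact Finset.sum_pos' (fun i _ => sq_nonneg _) ⟨i, Finset.mem_univ _, by
      have : x i ≠ 0 := hi
      positivity⟩
  nlinarith

lemma upper {n : ℕ} {M : Matrix (Fin n) (Fin n) ℝ} {ν : ℕ → ℝ}
    {c : (Fin n → ℝ) →ₗ[ℝ] (Fin n → ℝ)} (hν : ∀ i j, i ≤ j → j < n → ν j ≤ ν i)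
    (hq : ∀ x, qf M x = ∑ i : Fin n, ν i * (c x i) ^ 2)
    (hn : ∀ x, ∑ i, x i ^ 2 = ∑ i : Fin n, (c x i) ^ 2)
    (m : ℕ) (φ : (Fin n → ℝ) →ₗ[ℝ] (Fin m → ℝ)) (a : ℝ)
    (hs : ∀ x : Fin n → ℝ, φ x = 0 → qf M x ≤ a * ∑ i, x i ^ 2)
    (p : ℕ) (hp : m ≤ p) (hpn : p < n) : ν p ≤ a := by
  by_contra hlt
  push Not at hlt
  let f : (Fin n → ℝ) →ₗ[ℝ] (Fin m → ℝ) × (Fin (n - p - 1) → ℝ) :=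
    LinearMap.prod φ
      ((LinearMap.funLeft ℝ ℝ (fun i : Fin (n - p - 1) => (⟨i + p + 1, by omega⟩ : Fin n))).comp c)
  have hk : LinearMap.ker f ≠ ⊥ := by
    apply LinearMap.ker_ne_bot_of_finrank_lt
    simp
    omega
  obtain ⟨x, hx, hx0⟩ := Submodule.exists_mem_ne_zero_of_ne_bot hk
  have hx' : f x = 0 := hx
  have h1 : φ x = 0 := congrArg Prod.fst hx'
  have h2 : ∀ i : Fin n, p < i.val → c x i = 0 := fun i hi => by
    have := congrFun (congrArg Prod.snd hx') ⟨i - p - 1, by omega⟩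
    have h : (⟨i - p - 1 + p + 1, by omega⟩ : Fin n) = i := by ext; simp; omega
    change c x ⟨i - p - 1 + p + 1, by omega⟩ = 0 at this
    rwa [h] at this
  have h3 := hs x h1
  rw [hq] at h3
  have h4 : ν p * ∑ i, x i ^ 2 ≤ ∑ i : Fin n, ν i * (c x i) ^ 2 := by
    rw [hn, Finset.mul_sum]
    refine Finset.sum_le_sum fun i _ => ?_
    by_cases hi : p < i.val
    · simp [h2 i hi]
    · exact mul_le_mul_of_nonneg_right (hν _ _ (by omega) hpn) (sq_nonneg _)
  have h5 : 0 < ∑ i, x i ^ 2 := by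
    obtain ⟨i, hi⟩ := Function.ne_iff.mp hx0
    exact Finset.sum_pos' (fun i _ => sq_nonneg _) ⟨i, Finset.mem_univ _, by
      have : x i ≠ 0 := hi
      positivity⟩
  nlinarith

lemma top_ge {n : ℕ} {M : Matrix (Fin n) (Fin n) ℝ} {ν : ℕ → ℝ}
    {c : (Fin n → ℝ) →ₗ[ℝ] (Fin n → ℝ)} (hν : ∀ i j, i ≤ j → j < n → ν j ≤ ν i)
    (hq : ∀ x, qf M x = ∑ i : Fin n, ν i * (c x i) ^ 2)
    (hn : ∀ x, ∑ i, x i ^ 2 = ∑ i : Fin n, (c x i) ^ 2) :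
    ∑ i, ∑ j, M i j ≤ ν 0 * n := by
  have h1 : qf M (fun _ => 1) = ∑ i, ∑ j, M i j := by simp [qf]
  have h2 := hn (fun _ => 1)
  simp only [one_pow, Finset.sum_const, Finset.card_univ, Fintype.card_fin, nsmul_eq_mul,
    mul_one] at h2
  rw [← h1, hq, h2, Finset.mul_sum]
  exact Finset.sum_le_sum fun i _ =>
    mul_le_mul_of_nonneg_right (hν _ _ (by omega) i.2) (sq_nonneg _)

lemma tree_no_tri {n : ℕ} {T : SimpleGraph (Fin n)} (hT : T.IsTree) {a b c : Fin n}
    (hab : T.Adj a b) (hac : T.Adj a c) : ¬ T.Adj b c := by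
  intro hbc
  apply hT.dist_ne_of_adj a hbc
  rw [SimpleGraph.dist_eq_one_iff_adj.mpr hab, SimpleGraph.dist_eq_one_iff_adj.mpr hac]

lemma tree_no_sq {n : ℕ} {T : SimpleGraph (Fin n)} (hT : T.IsTree) {a b c v : Fin n}
    (hab : T.Adj a b) (hbc : T.Adj b c) (hav : T.Adj a v) (hvc : T.Adj v c) (hac : a ≠ c) :
    v = b := by
  have h1 : (Walk.cons hab (Walk.cons hbc Walk.nil)).IsPath := by
    simp [hab.ne, hbc.ne, hac]
  have h2 : (Walk.cons hav (Walk.cons hvc Walk.nil)).IsPath := by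
    simp [hav.ne, hvc.ne, hac]
  have h := (hT.isAcyclic.subsingleton_path a c).elim ⟨_, h1⟩ ⟨_, h2⟩
  have h' := congrArg (fun p : T.Path a c => p.1.support) h
  simp at h'
  exact h'.symm

lemma dist_nbrs {n : ℕ} {T : SimpleGraph (Fin n)} (hT : T.IsTree) {c u v : Fin n}
    (hu : T.Adj c u) (hv : T.Adj c v) (huv : u ≠ v) : T.dist u v = 2 := by
  have h1 := hT.connected.one_lt_dist_of_ne_of_not_adj huv (tree_no_tri hT hu hv)
  have h2 := SimpleGraph.dist_le (Walk.cons hu.symm (Walk.cons hv Walk.nil))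
  simp at h2
  omega

lemma far {n : ℕ} {T : SimpleGraph (Fin n)} (hT : T.IsTree) {a b c d : Fin n}
    (hab : T.Adj a b) (hbc : T.Adj b c) (hcd : T.Adj c d) (hac : a ≠ c) (hbd : b ≠ d)
    (v : Fin n) (hv : v ∉ ({a, b, c, d} : Finset (Fin n))) :
    ∃ w ∈ ({a, b, c, d} : Finset (Fin n)), 3 ≤ T.dist v w := by
  by_contra hcon
  push Not at hcon
  simp only [Finset.mem_insert, Finset.mem_singleton, not_or] at hv
  obtain ⟨ha, hb, hc, hd⟩ := hv
  have ea := hcon a (by simp)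
  have eb := hcon b (by simp)
  have ec := hcon c (by simp)
  have ed := hcon d (by simp)
  have pa := hT.connected.pos_dist_of_ne ha
  have pb := hT.connected.pos_dist_of_ne hb
  have pc := hT.connected.pos_dist_of_ne hc
  have pd := hT.connected.pos_dist_of_ne hd
  have n1 := hT.dist_ne_of_adj v hab
  have n2 := hT.dist_ne_of_adj v hbc
  have n3 := hT.dist_ne_of_adj v hcd
  have : (T.dist v a = 1 ∧ T.dist v c = 1) ∨ (T.dist v b = 1 ∧ T.dist v d = 1) := by omega
  rcases this with ⟨h1, h2⟩ | ⟨h1, h2⟩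
  · rw [SimpleGraph.dist_eq_one_iff_adj] at h1 h2
    exact hb (tree_no_sq hT hab hbc h1.symm h2 hac)
  · rw [SimpleGraph.dist_eq_one_iff_adj] at h1 h2
    exact hc (tree_no_sq hT hbc hcd h1.symm h2 hbd)

lemma boundary {n : ℕ} {T : SimpleGraph (Fin n)} (hT : T.Connected) (s : Finset (Fin n))
    {u w : Fin n} (hu : u ∈ s) (hw : w ∉ s) : ∃ x ∈ s, ∃ y ∉ s, T.Adj x y := by
  obtain ⟨p⟩ := hT u w
  obtain ⟨d, _, h1, h2⟩ := p.exists_boundary_dart (s : Set (Fin n)) (by simpa using hu)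
    (by simpa using hw)
  exact ⟨d.fst, by simpa using h1, d.snd, by simpa using h2, d.adj⟩

lemma cluster {n : ℕ} {T : SimpleGraph (Fin n)} (hT : T.Connected) (u : Fin n) (j : ℕ)
    (hj : j < n) : ∃ s : Finset (Fin n), u ∈ s ∧ s.card = j + 1 ∧ ∀ v ∈ s, T.dist u v ≤ j := by
  induction j with
  | zero => exact ⟨{u}, by simp⟩
  | succ j ih =>
    obtain ⟨s, hu, hc, hd⟩ := ih (by omega)
    have : ∃ w, w ∉ s := by
      by_contra! h
      have : s = Finset.univ := by ext; simp [h]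
      rw [this] at hc
      simp at hc
      omega
    obtain ⟨w, hw⟩ := this
    obtain ⟨x, hx, y, hy, hxy⟩ := boundary hT s hu hw
    refine ⟨insert y s, by simp [hu], by simp [hy, hc], ?_⟩
    intro v hv
    rcases Finset.mem_insert.mp hv with rfl | hv
    · have h1 := hT.dist_triangle (u := u) (v := x) (w := v)
      have h2 := SimpleGraph.dist_eq_one_iff_adj.mpr hxy
      have := hd x hx
      omega
    · have := hd v hv
      omega

lemma star_adj {n : ℕ} {T : SimpleGraph (Fin n)} (hT : T.IsTree) {c : Fin n}
    (hc : ∀ v, v ≠ c → T.Adj c v) (u v : Fin n) :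
    T.Adj u v ↔ (u = c ∧ v ≠ c) ∨ (u ≠ c ∧ v = c) := by
  constructor
  · intro h
    by_cases hu : u = c
    · exact Or.inl ⟨hu, fun hv => h.ne (hu.trans hv.symm)⟩
    · refine Or.inr ⟨hu, ?_⟩
      by_contra hv
      exact tree_no_tri hT (hc u hu) (hc v hv) h
  · rintro (⟨rfl, h⟩ | ⟨h, rfl⟩)
    · exact hc v h
    · exact (hc u h).symm

lemma star_iso {n : ℕ} {T : SimpleGraph (Fin n)} (hT : T.IsTree) :
    Nonempty (T ≃g completeBipartiteGraph (Fin 1) (Fin (n - 1))) ↔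
      ∃ c : Fin n, ∀ v, v ≠ c → T.Adj c v := by
  constructor
  · rintro ⟨e⟩
    refine ⟨e.symm (Sum.inl 0), fun v hv => ?_⟩
    rw [← e.map_adj_iff]
    have hv' : e v ≠ Sum.inl 0 := fun h => hv (by rw [← h]; simp)
    rcases h : e v with i | i
    · exact absurd (h.trans (by rw [Subsingleton.elim i 0])) hv'
    · simp
  · rintro ⟨c, hc⟩
    have e1 : {v : Fin n // v = c} ≃ Fin 1 := Fintype.equivOfCardEq (by simp)
    have e2 : {v : Fin n // ¬ v = c} ≃ Fin (n - 1) := Fintype.equivOfCardEq (by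
      rw [Fintype.card_subtype_compl]; simp)
    let e : Fin n ≃ Fin 1 ⊕ Fin (n - 1) :=
      (Equiv.sumCompl (fun v : Fin n => v = c)).symm.trans (Equiv.sumCongr e1 e2)
    have hl : ∀ v, v = c → ∃ i, e v = Sum.inl i := fun v h =>
      ⟨e1 ⟨v, h⟩, by rw [← Equiv.eq_symm_apply]; simp [e]⟩
    have hr : ∀ v, ¬ v = c → ∃ i, e v = Sum.inr i := fun v h =>
      ⟨e2 ⟨v, h⟩, by rw [← Equiv.eq_symm_apply]; simp [e]⟩
    refine ⟨⟨e, ?_⟩⟩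
    intro u v
    rw [star_adj hT hc]
    by_cases hu : u = c <;> by_cases hv : v = c
    · obtain ⟨i, hi⟩ := hl u hu
      obtain ⟨j, hj⟩ := hl v hv
      simp [hu, hv]
    · obtain ⟨i, hi⟩ := hl u hu
      obtain ⟨j, hj⟩ := hr v hv
      rw [hi, hj]; simp [hu, hv]
    · obtain ⟨i, hi⟩ := hr u hu
      obtain ⟨j, hj⟩ := hl v hv
      rw [hi, hj]; simp [hu, hv]
    · obtain ⟨i, hi⟩ := hr u hu
      obtain ⟨j, hj⟩ := hr v hv
      rw [hi, hj]; simp [hu, hv]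

lemma star_qf {n : ℕ} {T : SimpleGraph (Fin n)} (hT : T.IsTree) {c : Fin n}
    (hc : ∀ v, v ≠ c → T.Adj c v) (x : Fin n → ℝ) :
    qf (distMatrix T) x = 2 * (∑ i, x i) ^ 2 - 2 * ∑ i, x i ^ 2 - 2 * x c * (∑ i, x i)
      + 2 * x c ^ 2 := by
  have hD : ∀ u v, distMatrix T u v = 2 - 2 * (if u = v then 1 else 0) - (if u = c then 1 else 0)
      - (if v = c then 1 else 0) + 2 * ((if u = c then 1 else 0) * (if v = c then 1 else 0)) := by
    intro u v
    by_cases huv : u = v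
    · subst huv
      by_cases hu : u = c <;> simp [distMatrix, hu] <;> norm_num
    · by_cases hu : u = c
      · have hv : v ≠ c := fun h => huv (hu.trans h.symm)
        have := SimpleGraph.dist_eq_one_iff_adj.mpr (hc v hv)
        subst hu
        simp [distMatrix, huv, hv, this]; norm_num
      · by_cases hv : v = c
        · have := SimpleGraph.dist_eq_one_iff_adj.mpr (hc u hu).symm
          subst hv
          simp [distMatrix, huv, this]; norm_num
        · have := dist_nbrs hT (hc u hu) (hc v hv) huv
          simp [distMatrix, huv, hu, hv, this]
  have hrow : ∀ i, ∑ j, distMatrix T i j * x i * x j =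
      2 * x i * (∑ j, x j) - 2 * x i ^ 2 - (if i = c then x i else 0) * (∑ j, x j) - x i * x c
        + 2 * (if i = c then x i else 0) * x c := by
    intro i
    have : ∀ j, distMatrix T i j * x i * x j = 2 * x i * x j - 2 * (if i = j then x i * x j else 0)
        - (if i = c then x i else 0) * x j - x i * (if j = c then x j else 0)
        + 2 * (if i = c then x i else 0) * (if j = c then x j else 0) := by
      intro j
      rw [hD]
      split_ifs <;> ring
    simp only [this, Finset.sum_add_distrib, Finset.sum_sub_distrib, ← Finset.mul_sum,
      Finset.sum_ite_eq, Finset.sum_ite_eq', Finset.mem_univ, if_true]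
    ring
  rw [qf]
  simp only [hrow, Finset.sum_add_distrib, Finset.sum_sub_distrib, ← Finset.mul_sum,
    ← Finset.sum_mul, Finset.sum_ite_eq', Finset.mem_univ, if_true]
  ring

lemma star_eigsum {n k : ℕ} (hk : 2 ≤ k) (hkn : k ≤ n) {T : SimpleGraph (Fin n)} (hT : T.IsTree)
    {c : Fin n} (hc : ∀ v, v ≠ c → T.Adj c v) : distEigSum T k = 2 * (n : ℝ) - 2 * k := by
  obtain ⟨ν, C, hν, hq, hn, hS, h0⟩ := spec T
  have hlow : ∀ p < n, -2 ≤ ν p := by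
    intro p hp
    refine lower hν hq hn Finset.univ (-2) ?_ p (by simpa using hp)
    intro x _
    rw [star_qf hT hc]
    nlinarith [sq_nonneg (∑ i, x i), sq_nonneg (x c), sq_nonneg ((∑ i, x i) - x c)]
  have hup : ∀ p, 2 ≤ p → p < n → ν p ≤ -2 := by
    intro p hp2 hp
    let φ : (Fin n → ℝ) →ₗ[ℝ] (Fin 2 → ℝ) :=
      LinearMap.pi ![∑ i, LinearMap.proj i, LinearMap.proj c]
    refine upper hν hq hn 2 φ (-2) ?_ p hp2 hp
    intro x hx
    have h1 : ∑ i, x i = 0 := by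
      have := congrFun hx 0
      simpa [φ] using this
    have h2 : x c = 0 := by
      have := congrFun hx 1
      simpa [φ] using this
    rw [star_qf hT hc, h1, h2]
    simp
  have hsplit := Finset.sum_range_add_sum_Ico ν hkn
  have htail : ∑ i ∈ Finset.Ico k n, ν i = ∑ i ∈ Finset.Ico k n, (-2 : ℝ) := by
    refine Finset.sum_congr rfl fun i hi => ?_
    rw [Finset.mem_Ico] at hi
    exact le_antisymm (hup i (by omega) hi.2) (hlow i hi.2)
  rw [hS k hkn]
  rw [htail] at hsplit
  simp [Nat.cast_sub hkn] at hsplit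
  linarith

lemma qf_support {n : ℕ} (M : Matrix (Fin n) (Fin n) ℝ) (s : Finset (Fin n)) (x : Fin n → ℝ)
    (hx : ∀ i ∉ s, x i = 0) : qf M x = ∑ i ∈ s, ∑ j ∈ s, M i j * x i * x j := by
  rw [qf, ← Finset.sum_subset (Finset.subset_univ s)
    (fun i _ hi => by simp [hx i hi])]
  refine Finset.sum_congr rfl fun i _ => ?_
  rw [← Finset.sum_subset (Finset.subset_univ s) (fun i _ hi => by simp [hx i hi])]

lemma sq_support {n : ℕ} (s : Finset (Fin n)) (x : Fin n → ℝ)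
    (hx : ∀ i ∉ s, x i = 0) : ∑ i, x i ^ 2 = ∑ i ∈ s, x i ^ 2 := by
  rw [← Finset.sum_subset (Finset.subset_univ s) (fun i _ hi => by simp [hx i hi])]

lemma form_nbrs {n : ℕ} {T : SimpleGraph (Fin n)} (hT : T.IsTree) {c : Fin n}
    (s : Finset (Fin n)) (hs : ∀ v ∈ s, T.Adj c v) (x : Fin n → ℝ) (hx : ∀ i ∉ s, x i = 0) :
    -2 * ∑ i, x i ^ 2 ≤ qf (distMatrix T) x := by
  rw [qf_support _ s x hx, sq_support s x hx]
  have : ∀ i ∈ s, ∑ j ∈ s, distMatrix T i j * x i * x j =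
      2 * x i * (∑ j ∈ s, x j) - 2 * x i ^ 2 := by
    intro i hi
    have : ∀ j ∈ s, distMatrix T i j * x i * x j =
        2 * x i * x j - (if i = j then 2 * x i * x j else 0) := by
      intro j hj
      by_cases hij : i = j
      · simp [distMatrix, hij]
      · simp [distMatrix, hij, dist_nbrs hT (hs i hi) (hs j hj) hij]
    rw [Finset.sum_congr rfl this, Finset.sum_sub_distrib, Finset.sum_ite_eq, if_pos hi,
      ← Finset.mul_sum]
    ring
  rw [Finset.sum_congr rfl this, Finset.sum_sub_distrib, ← Finset.mul_sum, ← Finset.sum_mul,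
    ← Finset.mul_sum]
  nlinarith [sq_nonneg (∑ j ∈ s, x j)]

lemma form_edge {n : ℕ} {T : SimpleGraph (Fin n)} {a b : Fin n}
    (h : T.Adj a b) (x : Fin n → ℝ) (hx : ∀ i ∉ ({a, b} : Finset (Fin n)), x i = 0) :
    -1 * ∑ i, x i ^ 2 ≤ qf (distMatrix T) x := by
  rw [qf_support _ _ x hx, sq_support _ x hx]
  have h1 := SimpleGraph.dist_eq_one_iff_adj.mpr h
  have h2 := SimpleGraph.dist_eq_one_iff_adj.mpr h.symm
  simp only [Finset.sum_pair h.ne, distMatrix, h1, h2, SimpleGraph.dist_self]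
  push_cast
  nlinarith [sq_nonneg (x a + x b)]

lemma form_cluster {n : ℕ} {T : SimpleGraph (Fin n)} (hT : T.Connected) (s : Finset (Fin n))
    (u : Fin n) (k : ℕ) (hd : ∀ v ∈ s, T.dist u v ≤ k) (hs : s.card = k)
    (x : Fin n → ℝ) (hx : ∀ i ∉ s, x i = 0) :
    -(2 * (k : ℝ) ^ 2) * ∑ i, x i ^ 2 ≤ qf (distMatrix T) x := by
  rw [qf_support _ s x hx, sq_support s x hx]
  have : ∀ i ∈ s, ∀ j ∈ s, -(k : ℝ) * x i ^ 2 + -(k : ℝ) * x j ^ 2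
      ≤ distMatrix T i j * x i * x j := by
    intro i hi j hj
    have h1 : T.dist i j ≤ 2 * k := by
      have h := hT.dist_triangle (u := i) (v := u) (w := j)
      have h2 := hd i hi
      have h3 := hd j hj
      rw [SimpleGraph.dist_comm] at h2
      omega
    have h2 : distMatrix T i j ≤ 2 * k := by
      rw [distMatrix]; exact_mod_cast h1
    have h3 : 0 ≤ distMatrix T i j := by rw [distMatrix]; positivity
    nlinarith [mul_nonneg h3 (sq_nonneg (x i + x j)),
      mul_nonneg (sub_nonneg.mpr h2) (add_nonneg (sq_nonneg (x i)) (sq_nonneg (x j)))]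
  refine le_trans (le_of_eq ?_)
    (Finset.sum_le_sum fun i hi => Finset.sum_le_sum fun j hj => this i hi j hj)
  simp only [Finset.sum_add_distrib, ← Finset.mul_sum, Finset.sum_const, hs, nsmul_eq_mul]
  ring

open Classical in
lemma wiener_nonstar {n : ℕ} {T : SimpleGraph (Fin n)} (hT : T.IsTree) {a b c d : Fin n}
    (hab : T.Adj a b) (hbc : T.Adj b c) (hcd : T.Adj c d) (hac : a ≠ c) (hbd : b ≠ d) :
    2 * (n : ℝ) ^ 2 - 2 * n - 6 ≤ ∑ i, ∑ j, distMatrix T i j := by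
  set P : Finset (Fin n) := {a, b, c, d} with hP
  have hPc : P.card ≤ 4 := Finset.card_le_four
  let E : Fin n → Fin n → ℝ := fun i j => if 3 ≤ T.dist i j then 1 else 0
  have hE0 : ∀ i j, 0 ≤ E i j := fun i j => by simp only [E]; split_ifs <;> norm_num
  have hEs : ∀ i j, E i j = E j i := fun i j => by simp only [E, SimpleGraph.dist_comm]
  have hD : ∀ i j, 2 - (if i = j then 2 else 0) - (if T.Adj i j then 1 else 0) + E i j
      ≤ distMatrix T i j := by
    intro i j
    by_cases hij : i = j
    · simp [hij, distMatrix, E]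
    · by_cases hadj : T.Adj i j
      · have := SimpleGraph.dist_eq_one_iff_adj.mpr hadj
        simp [hij, hadj, distMatrix, E, this]; norm_num
      · have := hT.connected.one_lt_dist_of_ne_of_not_adj hij hadj
        simp only [hij, hadj, distMatrix, E, if_false]
        split_ifs with h3
        · have : (3 : ℝ) ≤ T.dist i j := by exact_mod_cast h3
          linarith
        · have : (2 : ℝ) ≤ T.dist i j := by exact_mod_cast this
          linarith
  have hrow : ∀ i ∉ P, 1 ≤ ∑ j ∈ P, E i j := by
    intro i hi
    obtain ⟨w, hw, h3⟩ := far hT hab hbc hcd hac hbd i hi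
    have : E i w = 1 := by simp [E, h3]
    rw [← this]
    exact Finset.single_le_sum (fun j _ => hE0 i j) hw
  have hout : (n : ℝ) - 4 ≤ ∑ i ∈ Pᶜ, ∑ j ∈ P, E i j := by
    have h1 : ∑ i ∈ Pᶜ, (1 : ℝ) ≤ ∑ i ∈ Pᶜ, ∑ j ∈ P, E i j :=
      Finset.sum_le_sum fun i hi => hrow i (by simpa using hi)
    have h2 := Finset.card_add_card_compl P
    simp only [Finset.sum_const, nsmul_eq_mul, mul_one] at h1
    simp only [Fintype.card_fin] at h2
    have h3 : (P.card : ℝ) + (Pᶜ.card : ℝ) = n := by exact_mod_cast h2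
    have h4 : (P.card : ℝ) ≤ 4 := by exact_mod_cast hPc
    linarith
  have hEsum : 2 * (n : ℝ) - 8 ≤ ∑ i, ∑ j, E i j := by
    have h1 : ∑ i, ∑ j, E i j = ∑ i ∈ P, ∑ j, E i j + ∑ i ∈ Pᶜ, ∑ j, E i j :=
      (Finset.sum_add_sum_compl P _).symm
    have h2 : ∑ i ∈ Pᶜ, ∑ j ∈ P, E i j ≤ ∑ i ∈ Pᶜ, ∑ j, E i j :=
      Finset.sum_le_sum fun i _ =>
        Finset.sum_le_sum_of_subset_of_nonneg (Finset.subset_univ _) fun j _ _ => hE0 i j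
    have h3 : ∑ i ∈ P, ∑ j ∈ Pᶜ, E i j ≤ ∑ i ∈ P, ∑ j, E i j :=
      Finset.sum_le_sum fun i _ =>
        Finset.sum_le_sum_of_subset_of_nonneg (Finset.subset_univ _) fun j _ _ => hE0 i j
    have h4 : ∑ i ∈ P, ∑ j ∈ Pᶜ, E i j = ∑ i ∈ Pᶜ, ∑ j ∈ P, E i j := by
      rw [Finset.sum_comm]
      exact Finset.sum_congr rfl fun i _ => Finset.sum_congr rfl fun j _ => hEs _ _
    linarith
  have hadj : ∑ i, ∑ j, (if T.Adj i j then (1 : ℝ) else 0) = 2 * n - 2 := by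
    have h1 : ∀ i, ∑ j, (if T.Adj i j then (1 : ℝ) else 0) = T.degree i := by
      intro i
      rw [Finset.sum_boole, ← SimpleGraph.card_neighborFinset_eq_degree]
      congr 2
      ext j; simp
    simp only [h1]
    have h2 := T.sum_degrees_eq_twice_card_edges
    have h3 := hT.card_edgeFinset
    simp only [Fintype.card_fin] at h3
    have h4 : (∑ i, (T.degree i : ℝ)) = 2 * (T.edgeFinset.card : ℝ) := by exact_mod_cast h2
    have h5 : (T.edgeFinset.card : ℝ) + 1 = n := by exact_mod_cast h3
    linarith
  refine le_trans ?_ (Finset.sum_le_sum fun i _ => Finset.sum_le_sum fun j _ => hD i j)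
  simp only [Finset.sum_add_distrib, Finset.sum_sub_distrib, Finset.sum_ite_eq, Finset.mem_univ,
    if_true, Finset.sum_const, Finset.card_univ, Fintype.card_fin, nsmul_eq_mul, hadj]
  nlinarith

open Classical in
lemma wiener_lowdeg {n k : ℕ} {T : SimpleGraph (Fin n)} (hT : T.IsTree)
    (hdeg : ∀ v, T.degree v < k) :
    3 * ((n : ℝ) - (k : ℝ) ^ 2) * n ≤ ∑ i, ∑ j, distMatrix T i j := by
  have hrow : ∀ i, 3 * ((n : ℝ) - (k : ℝ) ^ 2) ≤ ∑ j, distMatrix T i j := by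
    intro i
    let B : Finset (Fin n) := (insert i (T.neighborFinset i)).biUnion
      (fun w => insert w (T.neighborFinset w))
    have hins : ∀ w, (insert w (T.neighborFinset w)).card ≤ k := by
      intro w
      have h1 := Finset.card_insert_le w (T.neighborFinset w)
      have h2 := hdeg w
      rw [SimpleGraph.card_neighborFinset_eq_degree] at h1
      omega
    have hB : B.card ≤ k * k :=
      (Finset.card_biUnion_le_card_mul _ _ k fun w _ => hins w).trans
        (Nat.mul_le_mul_right k (hins i))
    have hfar : ∀ j ∈ Bᶜ, (3 : ℝ) ≤ distMatrix T i j := by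
      intro j hj
      rw [Finset.mem_compl] at hj
      rw [distMatrix]
      by_contra hlt
      apply hj
      have hlt' : T.dist i j < 3 := by
        by_contra h
        exact hlt (by exact_mod_cast not_lt.mp h)
      obtain ⟨p, hp⟩ := hT.connected.exists_walk_length_eq_dist i j
      rw [← hp] at hlt'
      simp only [B, Finset.mem_biUnion, Finset.mem_insert, SimpleGraph.mem_neighborFinset]
      match p, hlt' with
      | .nil, _ => exact ⟨_, Or.inl rfl, Or.inl rfl⟩
      | .cons h .nil, _ => exact ⟨_, Or.inl rfl, Or.inr h⟩
      | .cons h (.cons h' .nil), _ => exact ⟨_, Or.inr h, Or.inr h'⟩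
      | .cons h (.cons h' (.cons h'' q)), hl => simp at hl; omega
    have h1 : ∑ j ∈ Bᶜ, (3 : ℝ) ≤ ∑ j, distMatrix T i j :=
      (Finset.sum_le_sum hfar).trans
        (Finset.sum_le_sum_of_subset_of_nonneg (Finset.subset_univ _) fun j _ _ => by
          rw [distMatrix]; positivity)
    have h2 := Finset.card_add_card_compl B
    simp only [Fintype.card_fin] at h2
    have h3 : (B.card : ℝ) + (Bᶜ.card : ℝ) = n := by exact_mod_cast h2
    have h4 : (B.card : ℝ) ≤ k * k := by exact_mod_cast hB
    simp only [Finset.sum_const, nsmul_eq_mul] at h1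
    nlinarith
  have := Finset.sum_le_sum fun i (_ : i ∈ (Finset.univ : Finset (Fin n))) => hrow i
  simp only [Finset.sum_const, Finset.card_univ, Fintype.card_fin, nsmul_eq_mul] at this
  linarith

open Classical in
lemma nonstar_strict {n k : ℕ} (hk : 2 ≤ k) (hn : 2 * k ^ 3 + 3 * k ^ 2 + 10 ≤ n)
    {T : SimpleGraph (Fin n)} (hT : T.IsTree) (hns : ¬ ∃ c : Fin n, ∀ v, v ≠ c → T.Adj c v) :
    2 * (n : ℝ) - 2 * k < distEigSum T k := by
  obtain ⟨ν, C, hν, hq, hnm, hS, h0⟩ := spec T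
  have hk2 : k ≤ k ^ 2 := Nat.le_self_pow (by norm_num) k
  have hkn : k ≤ n := by nlinarith
  have hn10 : 10 ≤ n := by nlinarith
  have hnR : (10 : ℝ) ≤ n := by exact_mod_cast hn10
  have htop := top_ge hν hq hnm
  rw [hS k hkn]
  obtain ⟨m, rfl⟩ : ∃ m, k = m + 2 := ⟨k - 2, by omega⟩
  by_cases hdeg : ∀ v, T.degree v < m + 2
  · have hW := wiener_lowdeg hT hdeg
    have h1 : 3 * ((n : ℝ) - ((m + 2 : ℕ) : ℝ) ^ 2) ≤ ν 0 := by
      have : (0 : ℝ) < n := by linarith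
      exact le_of_mul_le_mul_right (hW.trans htop) this
    obtain ⟨s, _, hs, hd⟩ := cluster hT.connected ⟨0, by omega⟩ (m + 1) (by omega)
    have hlow : ∀ p < m + 2, -(2 * ((m + 2 : ℕ) : ℝ) ^ 2) ≤ ν p := by
      intro p hp
      refine lower hν hq hnm s _ ?_ p (by omega)
      exact form_cluster hT.connected s ⟨0, by omega⟩ (m + 2)
        (fun v hv => (hd v hv).trans (by omega)) (by omega)
    rw [Finset.sum_range_succ']
    have h2 : ∑ i ∈ Finset.range (m + 1), (-(2 * ((m + 2 : ℕ) : ℝ) ^ 2)) ≤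
        ∑ i ∈ Finset.range (m + 1), ν (i + 1) :=
      Finset.sum_le_sum fun i hi => hlow _ (by rw [Finset.mem_range] at hi; omega)
    simp only [Finset.sum_const, Finset.card_range, nsmul_eq_mul] at h2
    have hnR' : 2 * ((m : ℝ) + 2) ^ 3 + 3 * ((m : ℝ) + 2) ^ 2 + 10 ≤ n := by exact_mod_cast hn
    push_cast at h1 h2 ⊢
    have hm : (0 : ℝ) ≤ m := by positivity
    nlinarith [sq_nonneg ((m : ℝ) + 2)]
  · push Not at hdeg
    obtain ⟨c, hc⟩ := hdeg
    have hnbr : m + 2 ≤ (T.neighborFinset c).card := by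
      rwa [SimpleGraph.card_neighborFinset_eq_degree]
    have hlow : ∀ p < m + 2, -2 ≤ ν p := by
      intro p hp
      refine lower hν hq hnm (T.neighborFinset c) (-2) ?_ p (by omega)
      exact form_nbrs hT _ (fun v hv => by simpa using hv)
    obtain ⟨w, hw⟩ : ∃ w, w ∉ insert c (T.neighborFinset c) := by
      by_contra! h
      apply hns
      refine ⟨c, fun v hv => ?_⟩
      have := h v
      simpa [hv] using this
    obtain ⟨b, hb, a, ha, hba⟩ := boundary hT.connected _ (Finset.mem_insert_self c _) hw
    simp only [Finset.mem_insert, SimpleGraph.mem_neighborFinset, not_or] at hb ha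
    have hcb : T.Adj c b := by
      rcases hb with rfl | hb
      · exact absurd hba ha.2
      · exact hb
    obtain ⟨d, hd, hdb⟩ := Finset.exists_mem_ne (s := T.neighborFinset c) (by omega) b
    rw [SimpleGraph.mem_neighborFinset] at hd
    have hW := wiener_nonstar hT hba.symm hcb.symm hd ha.1 hdb.symm
    have h1 : 2 * (n : ℝ) - 3 < ν 0 := by
      have h := hW.trans htop
      by_contra hle
      push Not at hle
      nlinarith
    have h2 : -1 ≤ ν 1 := by
      refine lower hν hq hnm {c, b} (-1) (form_edge hcb) 1 ?_
      rw [Finset.card_pair hcb.ne]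
      norm_num
    rw [Finset.sum_range_succ', Finset.sum_range_succ']
    have h3 : ∑ i ∈ Finset.range m, (-2 : ℝ) ≤ ∑ i ∈ Finset.range m, ν (i + 1 + 1) :=
      Finset.sum_le_sum fun i hi => hlow _ (by rw [Finset.mem_range] at hi; omega)
    simp only [Finset.sum_const, Finset.card_range, nsmul_eq_mul] at h3
    push_cast
    norm_num at h2 h3 ⊢
    linarith

theorem sum_k_largest_distance_eigenvalues_tree_lower_bound :
    ∀ k : ℕ, 2 ≤ k → ∃ N : ℕ, ∀ n : ℕ, N ≤ n →
      ∀ T : SimpleGraph (Fin n), T.IsTree →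
        distEigSum T k ≥ 2 * (n : ℝ) - 2 * k ∧
        (distEigSum T k = 2 * (n : ℝ) - 2 * k ↔
          Nonempty (T ≃g completeBipartiteGraph (Fin 1) (Fin (n - 1)))) := by
  intro k hk
  refine ⟨2 * k ^ 3 + 3 * k ^ 2 + 10, fun n hn T hT => ?_⟩
  have hk2 : k ≤ k ^ 2 := Nat.le_self_pow (by norm_num) k
  have hkn : k ≤ n := by nlinarith
  rw [star_iso hT]
  by_cases hs : ∃ c : Fin n, ∀ v, v ≠ c → T.Adj c v
  · obtain ⟨c, hc⟩ := hs
    have h := star_eigsum hk hkn hT hc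
    exact ⟨h.ge, fun _ => ⟨c, hc⟩, fun _ => h⟩
  · have h := nonstar_strict hk hn hT hs
    exact ⟨h.le, fun he => absurd he h.ne', fun he => absurd he hs⟩
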